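/- Let G be a group with no element of order 2, and work in the free product G * ℤ. If a, b ∈ G * ℤ satisfy ab ≠ e and ab = (ba)⁻¹, then ab is conjugate in G * ℤ to an element of G. -/

import Mathlib

namespace Monoid.CoprodI

/-- The element of the free product represented by a list of letters. -/
def listProd {ι : Type*} {M : ι → Type*} [∀ i, Group (M i)] (L : List (Σ i, M i)) : CoprodI M :=
  (L.map fun p => of p.2).prod

/-- A list of letters is reduced if no letter is trivial and adjacent letters come from
different factors. -/
def IsReduced {ι : Type*} {M : ι → Type*} [∀ i, Group (M i)] (L : List (Σ i, M i)) : Prop :=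
  (∀ p ∈ L, p.2 ≠ 1) ∧ L.IsChain fun p q => p.1 ≠ q.1

section

variable {ι : Type*} {M : ι → Type*} [∀ i, Group (M i)]

@[simp]
theorem listProd_nil : listProd ([] : List (Σ i, M i)) = 1 := rfl

@[simp]
theorem listProd_cons (p : Σ i, M i) (L : List (Σ i, M i)) :
    listProd (p :: L) = of p.2 * listProd L := by
  simp [listProd]

@[simp]
theorem listProd_append (L K : List (Σ i, M i)) :
    listProd (L ++ K) = listProd L * listProd K := by
  simp [listProd]

theorem exists_isReduced_listProd_eq (x : CoprodI M) :
    ∃ L : List (Σ i, M i), IsReduced L ∧ listProd L = x := by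
  classical
  exact ⟨(Word.equiv x).toList, ⟨(Word.equiv x).ne_one, (Word.equiv x).chain_ne⟩,
    Word.equiv.symm_apply_apply x⟩

theorem IsReduced.eq_of_listProd_eq {L K : List (Σ i, M i)} (hL : IsReduced L)
    (hK : IsReduced K) (h : listProd L = listProd K) : L = K := by
  classical
  have : (⟨L, hL.1, hL.2⟩ : Word M) = ⟨K, hK.1, hK.2⟩ := Word.equiv.symm.injective h
  exact congrArg Word.toList this

theorem isReduced_append {L K : List (Σ i, M i)} :
    IsReduced (L ++ K) ↔
      IsReduced L ∧ IsReduced K ∧ ∀ p ∈ L.getLast?, ∀ q ∈ K.head?, p.1 ≠ q.1 := by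
  simp only [IsReduced, List.isChain_append, List.mem_append]
  grind

theorem isReduced_singleton {p : Σ i, M i} : IsReduced [p] ↔ p.2 ≠ 1 := by
  simp [IsReduced]

/-- The square of a reduced word is trivial or has a reduced form which starts and ends in the
same factors as the word itself and is not shorter. -/
theorem IsReduced.sq_listProd {L : List (Σ i, M i)} (hL : IsReduced L) :
    listProd L ^ 2 = 1 ∨ ∃ K : List (Σ i, M i), IsReduced K ∧ listProd K = listProd L ^ 2 ∧
      K.head?.map Sigma.fst = L.head?.map Sigma.fst ∧
      K.getLast?.map Sigma.fst = L.getLast?.map Sigma.fst ∧ L.length ≤ K.length := by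
  induction L using List.bidirectionalRec with
  | nil => simp
  | singleton p =>
    obtain ⟨i, m⟩ := p
    by_cases hm : m ^ 2 = 1
    · left
      simp [← map_pow, hm]
    · right
      exact ⟨[⟨i, m ^ 2⟩], isReduced_singleton.2 hm, by simp⟩
  | cons_append p L q ih =>
    obtain ⟨i, m⟩ := p
    obtain ⟨j, n⟩ := q
    by_cases hij : j = i
    swap
    · right
      refine ⟨(⟨i, m⟩ :: (L ++ [⟨j, n⟩])) ++ (⟨i, m⟩ :: (L ++ [⟨j, n⟩])), ?_, ?_⟩
      · simp only [isReduced_append (K := _ :: _), hL, true_and]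
        simp [List.getLast?_cons, hij]
      · simp [pow_two, mul_assoc, List.getLast?_cons]
    subst hij
    have hL' : IsReduced ([⟨j, m⟩] ++ (L ++ [⟨j, n⟩])) := hL
    rw [isReduced_append, isReduced_append] at hL'
    obtain ⟨hm, ⟨hLr, hn, hlast⟩, hfst⟩ := hL'
    have hne : L ≠ [] := by
      rintro rfl
      simp at hfst
    have hhead := List.head?_eq_some_head hne
    have hlast' := List.getLast?_eq_some_getLast hne
    simp only [hhead, hlast', List.head?_append, List.head?_cons, List.getLast?_singleton,
      Option.some_or, Option.mem_some, forall_eq'] at hfst hlast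
    by_cases hnm : n * m = 1
    · have hconj : (listProd (⟨j, m⟩ :: (L ++ [⟨j, n⟩])) : CoprodI M) ^ 2
          = of m * listProd L ^ 2 * of n := by
        have : (of n * of m : CoprodI M) = 1 := by rw [← map_mul, hnm, map_one]
        simp only [listProd_cons, listProd_append, listProd_nil, mul_one, pow_two]
        calc _ = of m * (listProd L * (of n * of m) * listProd L) * of n := by group
          _ = _ := by rw [this, mul_one]
      rw [hconj]
      obtain h | ⟨K, hK, hKL, hKh, hKl, hlen⟩ := ih hLr
      · left
        rw [h, mul_one, ← map_mul, mul_eq_one_comm.1 hnm, map_one]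
      · right
        refine ⟨[⟨j, m⟩] ++ (K ++ [⟨j, n⟩]), ?_, ?_⟩
        · have hKne : K ≠ [] := by
            rintro rfl
            simp at hlen
            exact hne hlen
          rw [isReduced_append, isReduced_append]
          simp only [hhead, hlast', List.head?_eq_some_head hKne,
            List.getLast?_eq_some_getLast hKne, Option.map_some, Option.some.injEq] at hKh hKl
          simp [hm, hK, hn, List.head?_eq_some_head hKne, List.getLast?_eq_some_getLast hKne,
            hKh, hKl, hlast, hfst]
        · simp [hKL, mul_assoc, List.getLast?_cons, hlen]
    · right
      refine ⟨[⟨j, m⟩] ++ (L ++ ([⟨j, n * m⟩] ++ (L ++ [⟨j, n⟩]))), ?_, ?_⟩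
      · have hnm' : IsReduced [(⟨j, n * m⟩ : Σ i, M i)] := isReduced_singleton.2 hnm
        simp only [isReduced_append, hm, hn, hLr, hnm', true_and]
        simp [hhead, hlast', hfst, hlast]
      · simp [pow_two, mul_assoc, List.getLast?_cons]

/-- Every element of a free product is conjugate to an element of a factor or to an element with a
nonempty cyclically reduced word. -/
theorem exists_conj_of_or_isReduced_append_self (x : CoprodI M) :
    ∃ g : CoprodI M, g * x * g⁻¹ = 1 ∨ (∃ (i : ι) (m : M i), g * x * g⁻¹ = of m) ∨
      ∃ L : List (Σ i, M i), L ≠ [] ∧ IsReduced (L ++ L) ∧ g * x * g⁻¹ = listProd L := by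
  obtain ⟨L, hL, rfl⟩ := exists_isReduced_listProd_eq x
  induction hlen : L.length using Nat.strong_induction_on generalizing L with
  | _ k ih =>
  induction L using List.bidirectionalRec with
  | nil => exact ⟨1, by simp⟩
  | singleton p => exact ⟨1, .inr <| .inl ⟨p.1, p.2, by simp⟩⟩
  | cons_append p L q _ =>
    obtain ⟨i, m⟩ := p
    obtain ⟨j, n⟩ := q
    by_cases hij : j = i
    swap
    · refine ⟨1, .inr <| .inr ⟨⟨i, m⟩ :: (L ++ [⟨j, n⟩]), by simp, ?_, by simp⟩⟩
      rw [isReduced_append (K := _ :: _)]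
      simp [hL, List.getLast?_cons, hij]
    subst hij
    have hL' : IsReduced ([⟨j, m⟩] ++ (L ++ [⟨j, n⟩])) := hL
    rw [isReduced_append, isReduced_append] at hL'
    obtain ⟨hm, ⟨hLr, hn, hlast⟩, hfst⟩ := hL'
    have key : ∃ K : List (Σ i, M i), IsReduced K ∧ K.length < k ∧
        listProd K = (of m)⁻¹ * listProd (⟨j, m⟩ :: (L ++ [⟨j, n⟩])) * of m := by
      by_cases hnm : n * m = 1
      · have : (of n * of m : CoprodI M) = 1 := by rw [← map_mul, hnm, map_one]
        exact ⟨L, hLr, by grind, by simp [mul_assoc, this]⟩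
      · refine ⟨L ++ [⟨j, n * m⟩], ?_, by grind, by simp [mul_assoc]⟩
        rw [isReduced_append]
        exact ⟨hLr, isReduced_singleton.2 hnm, by simpa using hlast⟩
    obtain ⟨K, hK, hKlen, hKL⟩ := key
    obtain ⟨g, hg⟩ := ih _ hKlen K hK rfl
    refine ⟨g * (of m)⁻¹, ?_⟩
    have : g * (of m)⁻¹ * listProd (⟨j, m⟩ :: (L ++ [⟨j, n⟩])) * (g * (of m)⁻¹)⁻¹
        = g * listProd K * g⁻¹ := by
      rw [hKL]
      group
    rwa [this]

/-- A free product of groups without elements of order two has no element of order two. -/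
theorem eq_one_of_sq_eq_one (hM : ∀ i (m : M i), m ^ 2 = 1 → m = 1) {x : CoprodI M}
    (hx : x ^ 2 = 1) : x = 1 := by
  obtain ⟨g, hg⟩ := exists_conj_of_or_isReduced_append_self x
  have hsq : (g * x * g⁻¹) ^ 2 = 1 := by simp [conj_pow, hx]
  obtain h | ⟨i, m, h⟩ | ⟨L, hne, hL, h⟩ := hg
  · simpa using h
  · rw [h, ← map_pow, ← map_one (of : M i →* CoprodI M)] at hsq
    rw [hM i m (of_injective i hsq), map_one] at h
    simpa using h
  · rw [h, pow_two, ← listProd_append, ← listProd_nil] at hsq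
    have := hL.eq_of_listProd_eq (by simp [IsReduced]) hsq
    simp_all

/-- Two square roots of the same element in a free product of groups without elements of order two
are equal or lie in a common conjugate of a factor. -/
theorem eq_or_exists_conj_of_sq_eq_sq (hM : ∀ i (m : M i), m ^ 2 = 1 → m = 1)
    {x y : CoprodI M} (hxy : x ^ 2 = y ^ 2) :
    x = y ∨ ∃ (g : CoprodI M) (i : ι) (m n : M i),
      g * x * g⁻¹ = of m ∧ g * y * g⁻¹ = of n := by
  by_cases hx1 : x ^ 2 = 1
  · left
    exact (eq_one_of_sq_eq_one hM hx1).trans (eq_one_of_sq_eq_one hM (hxy.symm.trans hx1)).symm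
  obtain ⟨g, hg⟩ := exists_conj_of_or_isReduced_append_self y
  have hsq : (g * x * g⁻¹) ^ 2 = (g * y * g⁻¹) ^ 2 := by simp [conj_pow, hxy]
  have hgx1 : (g * x * g⁻¹) ^ 2 ≠ 1 := by simpa [conj_pow] using hx1
  obtain ⟨K, hK, hKx⟩ := exists_isReduced_listProd_eq (g * x * g⁻¹)
  obtain h | ⟨K₂, hK₂, hprod, hhead, hlast, hlen⟩ := hK.sq_listProd
  · exact absurd h (by rwa [hKx])
  rw [hKx, hsq] at hprod
  obtain h | ⟨i, n, h⟩ | ⟨L, hne, hL, h⟩ := hg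
  · simp [hsq, h] at hgx1
  · right
    have hn : n ^ 2 ≠ 1 := fun hn => hgx1 <| by rw [hsq, h, ← map_pow, hn, map_one]
    have hK₂eq : K₂ = [⟨i, n ^ 2⟩] :=
      hK₂.eq_of_listProd_eq (isReduced_singleton.2 hn) (by simp [hprod, h])
    subst hK₂eq
    match K with
    | [] => simp at hhead
    | [⟨j, m⟩] =>
      obtain rfl : i = j := by simpa using hhead
      exact ⟨g, i, m, n, by simpa using hKx.symm, h⟩
    | _ :: _ :: _ => simp at hlen
  · left
    have hK₂eq : K₂ = L ++ L := hK₂.eq_of_listProd_eq hL (by simp [hprod, h, pow_two])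
    subst hK₂eq
    have hKK : IsReduced (K ++ K) := by
      rw [isReduced_append] at hL ⊢
      refine ⟨hK, hK, fun p hp q hq => ?_⟩
      have := hL.2.2 _ (List.getLast?_eq_some_getLast hne) _ (List.head?_eq_some_head hne)
      simp only [List.head?_append, List.getLast?_append, List.head?_eq_some_head hne,
        List.getLast?_eq_some_getLast hne, Option.mem_def.1 hp, Option.mem_def.1 hq,
        Option.some_or, Option.map_some, Option.some.injEq] at hhead hlast
      rwa [← hhead, ← hlast]
    have := hKK.eq_of_listProd_eq hL (by
      rw [listProd_append, listProd_append, hKx, ← h, ← pow_two, ← pow_two, hsq])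
    have hKL : K = L := (List.append_inj' this (by grind)).1
    rw [hKL, ← h] at hKx
    simpa using hKx.symm

end

end Monoid.CoprodI

namespace Monoid.Coprod

universe u v

/-- Two types as a family indexed by `Bool`. -/
def boolFamily (G : Type u) (H : Type v) : Bool → Type (max u v)
  | true => ULift.{v} G
  | false => ULift.{u} H

instance {G : Type u} {H : Type v} [Group G] [Group H] : ∀ b, Group (boolFamily G H b)
  | true => inferInstanceAs (Group (ULift.{v} G))
  | false => inferInstanceAs (Group (ULift.{u} H))

/-- Two square roots of the same element in a free product of two groups without elements of
order two are equal or lie in a common conjugate of a factor. -/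
theorem eq_or_exists_conj_of_sq_eq_sq {G : Type u} {H : Type v} [Group G] [Group H]
    (hG : ∀ g : G, g ^ 2 = 1 → g = 1) (hH : ∀ h : H, h ^ 2 = 1 → h = 1)
    {x y : Monoid.Coprod G H} (hxy : x ^ 2 = y ^ 2) :
    x = y ∨ (∃ (k : Monoid.Coprod G H) (m n : G), k * x * k⁻¹ = inl m ∧ k * y * k⁻¹ = inl n) ∨
      ∃ (k : Monoid.Coprod G H) (m n : H), k * x * k⁻¹ = inr m ∧ k * y * k⁻¹ = inr n := by
  let M := boolFamily G H
  let ψ : Monoid.Coprod G H →* CoprodI M :=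
    lift ((CoprodI.of (M := M) (i := true)).comp (MulEquiv.ulift (α := G)).symm.toMonoidHom)
      ((CoprodI.of (M := M) (i := false)).comp (MulEquiv.ulift (α := H)).symm.toMonoidHom)
  let f : ∀ b, M b →* Monoid.Coprod G H
    | true => inl.comp (MulEquiv.ulift (α := G)).toMonoidHom
    | false => inr.comp (MulEquiv.ulift (α := H)).toMonoidHom
  let φ : CoprodI M →* Monoid.Coprod G H := CoprodI.lift f
  have hφψ : ∀ z, φ (ψ z) = z := by
    have : φ.comp ψ = MonoidHom.id _ := by
      apply hom_ext <;> ext z <;> simp only [φ, ψ, MonoidHom.comp_apply, lift_apply_inl,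
        lift_apply_inr] <;> rfl
    exact DFunLike.congr_fun this
  have hM : ∀ b (m : M b), m ^ 2 = 1 → m = 1
    | true, m, h => ULift.down_injective (hG _ (congrArg ULift.down h))
    | false, m, h => ULift.down_injective (hH _ (congrArg ULift.down h))
  have hψ : ψ x ^ 2 = ψ y ^ 2 := by rw [← map_pow, ← map_pow, hxy]
  obtain h | ⟨k, b, m, n, hx, hy⟩ := CoprodI.eq_or_exists_conj_of_sq_eq_sq hM hψ
  · left
    rw [← hφψ x, h, hφψ]
  · right
    have hx' := congrArg φ hx
    have hy' := congrArg φ hy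
    simp only [map_mul, map_inv, hφψ, φ, CoprodI.lift_of] at hx' hy'
    cases b with
    | true => exact .inl ⟨_, _, _, hx', hy'⟩
    | false => exact .inr ⟨_, _, _, hx', hy'⟩

end Monoid.Coprod

theorem ab_conj_into_factor {G : Type*} [Group G]
    (hG : ∀ g : G, g ^ 2 = 1 → g = 1)
    (a b : Monoid.Coprod G (Multiplicative ℤ))
    (hne : a * b ≠ 1) (heq : a * b = (b * a)⁻¹) :
    ∃ g : G, IsConj (Monoid.Coprod.inl g) (a * b) := by
  have hsq : a⁻¹ ^ 2 = b ^ 2 := by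
    rw [eq_inv_iff_mul_eq_one] at heq
    have h : a * (b ^ 2 * a) = 1 := by simpa [pow_two, mul_assoc] using heq
    rw [inv_pow, pow_two a, mul_inv_rev, eq_comm, eq_mul_inv_iff_mul_eq]
    exact (inv_eq_of_mul_eq_one_right h).symm
  have hZ : ∀ z : Multiplicative ℤ, z ^ 2 = 1 → z = 1 := fun z hz =>
    (pow_eq_one_iff_left two_ne_zero).1 hz
  obtain h | ⟨k, m, n, hm, hn⟩ | ⟨k, m, n, hm, hn⟩ :=
    Monoid.Coprod.eq_or_exists_conj_of_sq_eq_sq hG hZ hsq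
  · exact absurd (by rw [← h, mul_inv_cancel]) hne
  · refine ⟨m⁻¹ * n, isConj_iff.2 ⟨k⁻¹, ?_⟩⟩
    rw [map_mul, map_inv, ← hm, ← hn]
    group
  · have hmn : m ^ 2 = n ^ 2 := by
      have h : (k * a⁻¹ * k⁻¹) ^ 2 = (k * b * k⁻¹) ^ 2 := by rw [conj_pow, conj_pow, hsq]
      rw [hm, hn, ← map_pow, ← map_pow] at h
      exact Monoid.Coprod.inr_injective h
    have hmn' : m = n := by
      rw [← div_eq_one]
      exact hZ _ (by rw [div_pow, hmn, div_self'])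
    rw [hmn', ← hn] at hm
    have h : a⁻¹ = b := by simpa using hm
    exact absurd (by rw [← h, mul_inv_cancel]) hne
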